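/- arXiv:1512.08927 — 2 statements merged into one kernel-verified Lean document; each statement's English description precedes it below -/
import Mathlib

section
/- Let W ⊆ ℂ be a nonempty open set and let μ : W → ℝ be a Lebesgue measurable function with μ(z) > 0 for almost every z ∈ W. Suppose there exists a > 0 such that μ^{-a} is locally integrable on W (i.e. ∫_K μ(z)^{-a} dV(z) < ∞ for every compact K ⊆ W). Then μ is an admissible weight: (i) for every z ∈ W there is a constant C_z > 0 such that |f(z)| ≤ C_z · (∫_W |f|² μ dV)^{1/2} for every holomorphic f : W → ℂ with ∫_W |f|² μ dV < ∞ (so every evaluation functional is continuous on the weighted Bergman space), and (ii) the weighted Bergman space L²_H(W,μ) is a closed subspace of L²(W,μ). -/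
open Complex MeasureTheory

/-- The weighted measure `μ(z) dV(z)` on `W`, where `dV` is two-dimensional Lebesgue
measure on `ℂ`. -/
noncomputable def weightedMeasure (W : Set ℂ) (μ : ℂ → ℝ) : Measure ℂ :=
  (volume.restrict W).withDensity (fun z => ENNReal.ofReal (μ z))

open Metric Set Filter Topology
open scoped ENNReal Real

theorem enorm_mul_two_pi_le_lintegral_circleMap {f : ℂ → ℂ} {c : ℂ} {s : ℝ}
    (hf : DiffContOnCl ℂ f (ball c |s|)) :
    ENNReal.ofReal (2 * π) * ‖f c‖ₑ ≤ ∫⁻ θ in Ioo (-π) π, ‖f (circleMap c s θ)‖ₑ := by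
  have hper : Function.Periodic (fun θ ↦ f (circleMap c s θ)) (2 * π) := fun θ ↦ by
    simp [periodic_circleMap c s θ]
  have hint : ∫ θ in (-π)..π, f (circleMap c s θ) = (2 * π) • f c := by
    have h := hper.intervalIntegral_add_eq 0 (-π)
    rw [zero_add, show -π + 2 * π = π by ring] at h
    rw [← h, ← hf.circleAverage, Real.circleAverage, smul_smul,
      mul_inv_cancel₀ Real.two_pi_pos.ne', one_smul]
  have hnorm : ENNReal.ofReal (2 * π) * ‖f c‖ₑ = ‖∫ θ in (-π)..π, f (circleMap c s θ)‖ₑ := by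
    rw [hint, enorm_smul, Real.enorm_eq_ofReal Real.two_pi_pos.le]
  rw [hnorm, intervalIntegral.integral_of_le (by linarith [Real.pi_pos]),
    integral_Ioc_eq_integral_Ioo]
  exact enorm_integral_le_lintegral_enorm _

/-- The area mean value inequality for holomorphic functions. -/
theorem area_mul_enorm_le_lintegral_ball {f : ℂ → ℂ} {c : ℂ} {r : ℝ}
    (hr : 0 ≤ r) (hf : DifferentiableOn ℂ f (ball c r)) :
    ENNReal.ofReal (π * r ^ 2) * ‖f c‖ₑ ≤ ∫⁻ z in ball c r, ‖f z‖ₑ := by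
  set G : ℂ → ℝ≥0∞ := (ball c r).indicator fun z ↦ ‖f z‖ₑ with hG
  have hGm : Measurable G := by
    classical
    have := (hf.continuousOn.measurable_piecewise (g := fun _ ↦ 0) continuousOn_const
      measurableSet_ball).enorm
    convert this using 1
    ext z
    by_cases hz : z ∈ ball c r <;> simp [hG, hz, -mem_ball]
  have hpolar : ∀ p : ℝ × ℝ,
      Complex.polarCoord.symm p + c = circleMap c p.1 p.2 := fun p ↦ by
    rw [Complex.polarCoord_symm_apply, circleMap, Complex.exp_mul_I]
    push_cast
    ring
  have hmeas : Measurable fun p : ℝ × ℝ ↦ ENNReal.ofReal p.1 * G (circleMap c p.1 p.2) := by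
    refine (measurable_fst.ennreal_ofReal).mul (hGm.comp ?_)
    unfold circleMap
    fun_prop
  have harea : ∫⁻ s in Ioo 0 r, ENNReal.ofReal s = ENNReal.ofReal (r ^ 2 / 2) := by
    have hi : IntegrableOn (fun s : ℝ ↦ s) (Ioo 0 r) :=
      (continuous_id.integrableOn_Icc (a := 0) (b := r)).mono_set Ioo_subset_Icc_self
    rw [← ofReal_integral_eq_lintegral_ofReal hi
      ((ae_restrict_mem measurableSet_Ioo).mono fun s hs ↦ hs.1.le),
      ← integral_Ioc_eq_integral_Ioo, ← intervalIntegral.integral_of_le hr, integral_id]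
    simp
  calc ENNReal.ofReal (π * r ^ 2) * ‖f c‖ₑ
      = ∫⁻ s in Ioo 0 r, ENNReal.ofReal s * (ENNReal.ofReal (2 * π) * ‖f c‖ₑ) := by
        rw [lintegral_mul_const _ ENNReal.measurable_ofReal, harea, ← mul_assoc,
          ← ENNReal.ofReal_mul (by positivity)]
        congr 2
        ring
    _ ≤ ∫⁻ s in Ioo 0 r, ∫⁻ θ in Ioo (-π) π, ENNReal.ofReal s * G (circleMap c s θ) := by
        refine setLIntegral_mono' measurableSet_Ioo fun s hs ↦ ?_
        have hsub : closedBall c |s| ⊆ ball c r := by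
          rw [abs_of_pos hs.1]
          exact closedBall_subset_ball hs.2
        rw [lintegral_const_mul' _ _ ENNReal.ofReal_ne_top]
        gcongr
        refine (enorm_mul_two_pi_le_lintegral_circleMap
          (hf.diffContOnCl_ball hsub)).trans_eq ?_
        refine lintegral_congr fun θ ↦ ?_
        rw [hG, indicator_of_mem]
        exact hsub (by simp [circleMap, mem_closedBall, dist_eq_norm])
    _ ≤ ∫⁻ s in Ioi 0, ∫⁻ θ in Ioo (-π) π, ENNReal.ofReal s * G (circleMap c s θ) :=
        lintegral_mono_set Ioo_subset_Ioi_self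
    _ = ∫⁻ p in _root_.polarCoord.target,
          ENNReal.ofReal p.1 • G (Complex.polarCoord.symm p + c) := by
        rw [_root_.polarCoord_target, Measure.volume_eq_prod, ← Measure.prod_restrict,
          lintegral_prod]
        · simp_rw [hpolar, smul_eq_mul]
        · simp_rw [hpolar, smul_eq_mul]
          exact hmeas.aemeasurable
    _ = ∫⁻ z in ball c r, ‖f z‖ₑ := by
        rw [Complex.lintegral_comp_polarCoord_symm fun z ↦ G (z + c),
          lintegral_add_right_eq_self G c, lintegral_indicator measurableSet_ball]

/-- The mean value inequality for the powers `‖h‖ ^ q`, `0 < q ≤ 1`, of a holomorphic function,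
up to a constant. -/
theorem ofReal_norm_rpow_mul_sq_le_lintegral_ball {h : ℂ → ℂ} {c : ℂ} {R q : ℝ}
    (hR : 0 ≤ R) (hq : 0 < q) (hq1 : q ≤ 1) (hh : DifferentiableOn ℂ h (ball c R))
    (hhc : ContinuousOn h (closedBall c R)) {w : ℂ} (hw : w ∈ closedBall c R) :
    ENNReal.ofReal (π / 4 * (‖h w‖ ^ q * (R - dist w c) ^ 2)) ≤
      ENNReal.ofReal ((4 ^ q⁻¹) ^ (1 - q)) * ∫⁻ u in ball c R, ‖h u‖ₑ ^ q := by
  have hcont : ContinuousOn (fun z ↦ ‖h z‖ ^ q * (R - dist z c) ^ 2) (closedBall c R) :=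
    (hhc.norm.rpow_const fun _ _ ↦ Or.inr hq.le).mul (by fun_prop)
  obtain ⟨v, hv, hmax⟩ := (isCompact_closedBall c R).exists_isMaxOn ⟨c, by simpa⟩ hcont
  have hwv : ‖h w‖ ^ q * (R - dist w c) ^ 2 ≤ ‖h v‖ ^ q * (R - dist v c) ^ 2 := hmax hw
  refine (ENNReal.ofReal_le_ofReal (mul_le_mul_of_nonneg_left hwv (by positivity))).trans ?_
  set ρ := (R - dist v c) / 2 with hρ
  have hδ : R - dist v c = 2 * ρ := by ring
  have hρ0 : 0 ≤ ρ := by have := mem_closedBall.1 hv; linarith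
  rw [hδ]
  rcases hρ0.eq_or_lt with hρ' | hρpos
  · simp [← hρ']
  rcases (norm_nonneg (h v)).eq_or_lt with hv0 | hvpos
  · simp [← hv0, Real.zero_rpow hq.ne']
  have hsub : ball v ρ ⊆ ball c R := ball_subset_ball' (by linarith)
  have hbound : ∀ u ∈ ball v ρ, ‖h u‖ ≤ 4 ^ q⁻¹ * ‖h v‖ := fun u hu ↦ by
    have hδu : ρ ≤ R - dist u c := by
      have := dist_triangle u v c
      have := mem_ball.1 hu
      linarith
    have h1 : ‖h u‖ ^ q * (R - dist u c) ^ 2 ≤ ‖h v‖ ^ q * (2 * ρ) ^ 2 := by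
      rw [← hδ]
      exact hmax (ball_subset_closedBall (hsub hu))
    have h2 : ‖h u‖ ^ q * ρ ^ 2 ≤ 4 * ‖h v‖ ^ q * ρ ^ 2 := by
      calc ‖h u‖ ^ q * ρ ^ 2 ≤ ‖h u‖ ^ q * (R - dist u c) ^ 2 := by gcongr
        _ ≤ ‖h v‖ ^ q * (2 * ρ) ^ 2 := h1
        _ = _ := by ring
    have h3 : ‖h u‖ ^ q ≤ (4 ^ q⁻¹ * ‖h v‖) ^ q := by
      rw [Real.mul_rpow (by positivity) (by positivity), Real.rpow_inv_rpow (by norm_num) hq.ne']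
      exact le_of_mul_le_mul_right h2 (by positivity)
    exact (Real.rpow_le_rpow_iff (norm_nonneg _) (by positivity) hq).1 h3
  have hmean := area_mul_enorm_le_lintegral_ball hρ0 (hh.mono hsub)
  have hpt : ∀ u ∈ ball v ρ,
      ‖h u‖ₑ ≤ ENNReal.ofReal ((4 ^ q⁻¹ * ‖h v‖) ^ (1 - q)) * ‖h u‖ₑ ^ q := fun u hu ↦ by
    rw [← ofReal_norm, ENNReal.ofReal_rpow_of_nonneg (norm_nonneg _) hq.le,
      ← ENNReal.ofReal_mul (by positivity)]
    refine ENNReal.ofReal_le_ofReal ?_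
    calc ‖h u‖ = ‖h u‖ ^ (1 - q) * ‖h u‖ ^ q := by
          rw [← Real.rpow_add_of_nonneg (norm_nonneg _) (by linarith) hq.le]; simp
      _ ≤ _ := by
          gcongr
          exact hbound u hu
  have hle : ENNReal.ofReal (π * ρ ^ 2) * ‖h v‖ₑ ≤
      ENNReal.ofReal ((4 ^ q⁻¹ * ‖h v‖) ^ (1 - q)) * ∫⁻ u in ball c R, ‖h u‖ₑ ^ q := by
    refine hmean.trans ((setLIntegral_mono' measurableSet_ball hpt).trans ?_)
    rw [lintegral_const_mul' _ _ ENNReal.ofReal_ne_top]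
    gcongr
  have hne : ENNReal.ofReal (‖h v‖ ^ (1 - q)) ≠ 0 := by
    simpa using Real.rpow_pos_of_pos hvpos _
  rw [← ENNReal.mul_le_mul_iff_right hne ENNReal.ofReal_ne_top]
  calc ENNReal.ofReal (‖h v‖ ^ (1 - q)) * ENNReal.ofReal (π / 4 * (‖h v‖ ^ q * (2 * ρ) ^ 2))
      = ENNReal.ofReal (π * ρ ^ 2) * ‖h v‖ₑ := by
        rw [← ofReal_norm, ← ENNReal.ofReal_mul (by positivity),
          ← ENNReal.ofReal_mul (by positivity)]
        congr 1
        have : ‖h v‖ ^ (1 - q) * ‖h v‖ ^ q = ‖h v‖ := by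
          rw [← Real.rpow_add hvpos]; simp
        linear_combination (π * ρ ^ 2) * this
    _ ≤ _ := hle
    _ = _ := by
        rw [Real.mul_rpow (by positivity) (by positivity), ENNReal.ofReal_mul (by positivity)]
        ring

theorem eLpNorm_two_sq_weightedMeasure {W : Set ℂ} {μ : ℂ → ℝ}
    (hmeas : AEMeasurable μ (volume.restrict W)) (f : ℂ → ℂ) :
    eLpNorm f 2 (weightedMeasure W μ) ^ 2 = ∫⁻ u in W, ENNReal.ofReal (μ u) * ‖f u‖ₑ ^ 2 := by
  rw [eLpNorm_eq_lintegral_rpow_enorm_toReal two_ne_zero ENNReal.ofNat_ne_top, weightedMeasure,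
    lintegral_withDensity_eq_lintegral_mul_non_measurable₀ _ hmeas.ennreal_ofReal
      (ae_of_all _ fun _ ↦ ENNReal.ofReal_lt_top), ← ENNReal.rpow_natCast, ← ENNReal.rpow_mul]
  simp

theorem lintegral_rpow_le_lintegral_mul_rpow_mul {α : Type*} [MeasurableSpace α] {ν : Measure α}
    {m F : α → ℝ≥0∞} {a : ℝ} (ha : 0 < a) (hm : AEMeasurable m ν) (hF : AEMeasurable F ν)
    (hm0 : ∀ᵐ x ∂ν, m x ≠ 0) (hmtop : ∀ᵐ x ∂ν, m x ≠ ∞) :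
    ∫⁻ x, F x ^ (a / (1 + a)) ∂ν ≤
      (∫⁻ x, m x * F x ∂ν) ^ (a / (1 + a)) * (∫⁻ x, m x ^ (-a) ∂ν) ^ (1 / (1 + a)) := by
  refine le_trans (lintegral_mono_ae ?_) (ENNReal.lintegral_mul_norm_pow_le (hm.mul hF)
    (hm.pow_const (-a)) (by positivity) (by positivity) (by field_simp; ring))
  filter_upwards [hm0, hmtop] with x h0 htop
  rw [Pi.mul_apply, ENNReal.mul_rpow_of_nonneg _ _ (by positivity), ← ENNReal.rpow_mul,
    mul_right_comm, ← ENNReal.rpow_add _ _ h0 htop,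
    show a / (1 + a) + -a * (1 / (1 + a)) = 0 by ring, ENNReal.rpow_zero, one_mul]

/-- Evaluations are bounded on the weighted Bergman space, uniformly on small discs. -/
theorem exists_enorm_le_mul_eLpNorm_weightedMeasure {W : Set ℂ} {μ : ℂ → ℝ}
    (hmeas : AEMeasurable μ (volume.restrict W)) (hpos : ∀ᵐ z ∂(volume.restrict W), 0 < μ z)
    {a : ℝ} (ha : 0 < a) {c : ℂ} {R : ℝ} (hR : 0 < R) (hc : closedBall c R ⊆ W)
    (hint : IntegrableOn (fun z ↦ μ z ^ (-a)) (closedBall c R)) :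
    ∃ C : ℝ, 0 < C ∧ ∀ f : ℂ → ℂ, DifferentiableOn ℂ f W → ∀ w ∈ closedBall c (R / 2),
      ‖f w‖ₑ ≤ ENNReal.ofReal C * eLpNorm f 2 (weightedMeasure W μ) := by
  set q := a / (1 + a) with hq
  have hq0 : 0 < q := by positivity
  have hq1 : q ≤ 1 := by rw [hq, div_le_one (by positivity)]; linarith
  have hbW : ball c R ⊆ W := ball_subset_closedBall.trans hc
  set A := ∫⁻ u in ball c R, ENNReal.ofReal (μ u) ^ (-a) with hA
  have hAtop : A ≠ ∞ := by
    have h1 : A = ∫⁻ u in ball c R, ENNReal.ofReal (μ u ^ (-a)) :=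
      lintegral_congr_ae <| (ae_restrict_of_ae_restrict_of_subset hbW hpos).mono fun u hu ↦
        ENNReal.ofReal_rpow_of_pos hu
    rw [h1]
    exact (hint.mono_set ball_subset_closedBall).lintegral_lt_top.ne
  set κ := ENNReal.ofReal (π / 4 * (R / 2) ^ 2) with hκ
  have hκ0 : κ ≠ 0 := by
    rw [hκ, Ne, ENNReal.ofReal_eq_zero, not_le]
    positivity
  set T := κ⁻¹ * (ENNReal.ofReal ((4 ^ q⁻¹) ^ (1 - q)) * A ^ (1 / (1 + a))) with hT
  have hTtop : T ≠ ∞ := ENNReal.mul_ne_top (ENNReal.inv_ne_top.2 hκ0)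
    (ENNReal.mul_ne_top ENNReal.ofReal_ne_top
      (ENNReal.rpow_ne_top_of_nonneg (by positivity) hAtop))
  refine ⟨(T ^ (2 * q)⁻¹).toReal + 1, by positivity, fun f hf w hw ↦ ?_⟩
  set E := eLpNorm f 2 (weightedMeasure W μ) with hE
  have hsq : DifferentiableOn ℂ (fun u ↦ f u ^ 2) W := hf.pow 2
  have hwR : R / 2 ≤ R - dist w c := by
    have := mem_closedBall.1 hw
    linarith
  have hball := ofReal_norm_rpow_mul_sq_le_lintegral_ball hR.le hq0 hq1 (hsq.mono hbW)
    (hsq.continuousOn.mono hc) (closedBall_subset_closedBall (by linarith) hw)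
  have hhold : ∫⁻ u in ball c R, ‖f u ^ 2‖ₑ ^ q ≤ (E ^ 2) ^ q * A ^ (1 / (1 + a)) := by
    have hpos' := ae_restrict_of_ae_restrict_of_subset hbW hpos
    refine (lintegral_rpow_le_lintegral_mul_rpow_mul ha
      (hmeas.mono_set hbW).ennreal_ofReal
      ((hsq.continuousOn.mono hbW).aemeasurable measurableSet_ball).enorm
      (hpos'.mono fun u hu ↦ (ENNReal.ofReal_pos.2 hu).ne')
      (ae_of_all _ fun _ ↦ ENNReal.ofReal_ne_top)).trans ?_
    rw [hE, eLpNorm_two_sq_weightedMeasure hmeas]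
    simp_rw [enorm_pow]
    gcongr
  have hmain : ‖f w‖ₑ ^ (2 * q) ≤ T * E ^ (2 * q) := by
    have h1 : κ * ‖f w‖ₑ ^ (2 * q) ≤
        ENNReal.ofReal ((4 ^ q⁻¹) ^ (1 - q)) * (E ^ (2 * q) * A ^ (1 / (1 + a))) := by
      calc κ * ‖f w‖ₑ ^ (2 * q)
          = ENNReal.ofReal (π / 4 * (‖f w ^ 2‖ ^ q * (R / 2) ^ 2)) := by
            rw [← ofReal_norm, ENNReal.ofReal_rpow_of_nonneg (norm_nonneg _) (by positivity), hκ,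
              ← ENNReal.ofReal_mul (by positivity), norm_pow, Real.rpow_mul (norm_nonneg _),
              Real.rpow_two]
            congr 1
            ring
        _ ≤ ENNReal.ofReal (π / 4 * (‖f w ^ 2‖ ^ q * (R - dist w c) ^ 2)) := by gcongr
        _ ≤ _ := hball.trans (mul_le_mul' le_rfl hhold)
        _ = _ := by rw [ENNReal.rpow_mul, ENNReal.rpow_two]
    calc ‖f w‖ₑ ^ (2 * q) = κ⁻¹ * (κ * ‖f w‖ₑ ^ (2 * q)) := by
          rw [← mul_assoc, ENNReal.inv_mul_cancel hκ0 ENNReal.ofReal_ne_top, one_mul]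
      _ ≤ κ⁻¹ * _ := mul_le_mul' le_rfl h1
      _ = _ := by rw [hT]; ring
  have h2q : 0 < 2 * q := by positivity
  calc ‖f w‖ₑ ≤ (T * E ^ (2 * q)) ^ (2 * q)⁻¹ := (ENNReal.le_rpow_inv_iff h2q).2 hmain
    _ = T ^ (2 * q)⁻¹ * E := by
        rw [ENNReal.mul_rpow_of_nonneg _ _ (by positivity), ENNReal.rpow_rpow_inv h2q.ne']
    _ ≤ _ := by
        gcongr
        exact (ENNReal.le_ofReal_iff_toReal_le
          (ENNReal.rpow_ne_top_of_nonneg (by positivity) hTtop) (by positivity)).2 (by linarith)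

theorem eLpNorm_two_weightedMeasure_eq_ofReal {W : Set ℂ} {μ : ℂ → ℝ}
    (hmeas : AEMeasurable μ (volume.restrict W)) (hpos : ∀ᵐ z ∂(volume.restrict W), 0 < μ z)
    {f : ℂ → ℂ} (hf : IntegrableOn (fun w ↦ ‖f w‖ ^ 2 * μ w) W) :
    eLpNorm f 2 (weightedMeasure W μ) =
      ENNReal.ofReal ((∫ w in W, ‖f w‖ ^ 2 * μ w) ^ ((1 : ℝ) / 2)) := by
  have hnonneg : 0 ≤ᵐ[volume.restrict W] fun w ↦ ‖f w‖ ^ 2 * μ w := by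
    filter_upwards [hpos] with w hw using by positivity
  have hsq : eLpNorm f 2 (weightedMeasure W μ) ^ 2 =
      ENNReal.ofReal (∫ w in W, ‖f w‖ ^ 2 * μ w) := by
    rw [eLpNorm_two_sq_weightedMeasure hmeas, ofReal_integral_eq_lintegral_ofReal hf hnonneg]
    refine lintegral_congr fun w ↦ ?_
    rw [ENNReal.ofReal_mul (by positivity), ENNReal.ofReal_pow (norm_nonneg _), ofReal_norm,
      mul_comm]
  rw [← ENNReal.ofReal_rpow_of_nonneg (integral_nonneg_of_ae hnonneg) (by norm_num), ← hsq,
    ← ENNReal.rpow_two, ← ENNReal.rpow_mul]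
  norm_num

/-- If sup norms over small discs are controlled by the `L²(ν)` norm, then the holomorphic
functions form a closed subset of `L²(ν)`. -/
theorem isClosed_setOf_ae_eq_differentiableOn {W : Set ℂ} (hW : IsOpen W) {ν : Measure ℂ}
    (hν : ∀ᵐ z ∂ν, z ∈ W)
    (hbound : ∀ z ∈ W, ∃ r > 0, ∃ C : ℝ, 0 < C ∧ ∀ f : ℂ → ℂ, DifferentiableOn ℂ f W →
      ∀ w ∈ closedBall z r, ‖f w‖ₑ ≤ ENNReal.ofReal C * eLpNorm f 2 ν) :
    IsClosed {f : Lp ℂ 2 ν | ∃ g : ℂ → ℂ, DifferentiableOn ℂ g W ∧ (f : ℂ → ℂ) =ᵐ[ν] g} := by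
  rw [← isSeqClosed_iff_isClosed]
  intro F f hF hlim
  choose g hgd hFg using hF
  have hcauchy : ∀ z ∈ W, ∃ r > 0, UniformCauchySeqOn g atTop (closedBall z r) := fun z hz ↦ by
    obtain ⟨r, hr, C, hC, hb⟩ := hbound z hz
    refine ⟨r, hr, Metric.uniformCauchySeqOn_iff.2 fun ε hε ↦ ?_⟩
    obtain ⟨N, hN⟩ := Metric.cauchySeq_iff.1 hlim.cauchySeq (ε / C) (by positivity)
    refine ⟨N, fun m hm n hn w hw ↦ ?_⟩
    have h1 : edist (g m w) (g n w) ≤ ENNReal.ofReal C * edist (F m) (F n) := by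
      rw [edist_eq_enorm_sub, Lp.edist_def]
      exact (hb _ ((hgd m).sub (hgd n)) w hw).trans_eq
        (congrArg _ (eLpNorm_congr_ae ((hFg m).sub (hFg n))).symm)
    rw [edist_dist, edist_dist, ← ENNReal.ofReal_mul hC.le,
      ENNReal.ofReal_le_ofReal_iff (by positivity)] at h1
    calc dist (g m w) (g n w) ≤ C * dist (F m) (F n) := h1
      _ < C * (ε / C) := by gcongr; exact hN m hm n hn
      _ = ε := by field_simp
  have hptwise : ∀ z ∈ W, ∃ l, Tendsto (fun n ↦ g n z) atTop (𝓝 l) := fun z hz ↦ by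
    obtain ⟨r, hr, h⟩ := hcauchy z hz
    exact cauchySeq_tendsto_of_complete (h.cauchySeq (mem_closedBall_self hr.le))
  choose! G hG using hptwise
  have hloc : TendstoLocallyUniformlyOn g G atTop W := by
    rw [tendstoLocallyUniformlyOn_iff_filter]
    intro z hz
    obtain ⟨r, hr, h⟩ := hcauchy z hz
    obtain ⟨s, hs, hsW⟩ := Metric.isOpen_iff.1 hW z hz
    have h2 := (h.mono (ball_subset_closedBall.trans (closedBall_subset_closedBall
      (min_le_left r s)))).tendstoUniformlyOn_of_tendsto (f := G)
      fun x hx ↦ hG x (hsW (ball_subset_ball (min_le_right r s) hx))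
    rw [tendstoUniformlyOn_iff_tendstoUniformlyOnFilter] at h2
    exact h2.mono_right (le_principal_iff.2
      (mem_nhdsWithin_of_mem_nhds (ball_mem_nhds z (lt_min hr hs))))
  refine ⟨G, hloc.differentiableOn (Eventually.of_forall hgd) hW, ?_⟩
  obtain ⟨k, hk, hkf⟩ := (tendstoInMeasure_of_tendsto_Lp hlim).exists_seq_tendsto_ae
  filter_upwards [hkf, ae_all_iff.2 hFg, hν] with z h1 h2 hz
  simp_rw [h2] at h1
  exact tendsto_nhds_unique h1 ((hG z hz).comp hk.tendsto_atTop)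

/-- if `μ` is a measurable a.e.-positive weight on a nonempty open set
`W ⊆ ℂ` and `μ⁻ᵃ` is locally integrable on `W` for some `a > 0`, then `μ` is an
admissible weight: (i) every evaluation functional is continuous on the weighted
Bergman space, and (ii) the weighted Bergman space is a closed subspace of `L²(W, μ)`. -/
theorem admissible_of_locally_integrable_inv_rpow
    (W : Set ℂ) (hW : IsOpen W) (hWne : W.Nonempty)
    (μ : ℂ → ℝ) (hmeas : AEMeasurable μ (volume.restrict W))
    (hpos : ∀ᵐ z ∂(volume.restrict W), 0 < μ z)
    (hloc : ∃ a : ℝ, 0 < a ∧ ∀ K : Set ℂ, K ⊆ W → IsCompact K →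
      IntegrableOn (fun z => μ z ^ (-a)) K) :
    (∀ z ∈ W, ∃ C : ℝ, 0 < C ∧ ∀ f : ℂ → ℂ, DifferentiableOn ℂ f W →
        IntegrableOn (fun w => ‖f w‖ ^ 2 * μ w) W →
        ‖f z‖ ≤ C * (∫ w in W, ‖f w‖ ^ 2 * μ w) ^ ((1 : ℝ) / 2)) ∧
    IsClosed {f : Lp ℂ 2 (weightedMeasure W μ) |
      ∃ g : ℂ → ℂ, DifferentiableOn ℂ g W ∧ (f : ℂ → ℂ) =ᵐ[weightedMeasure W μ] g} := by
  obtain ⟨a, ha, hint⟩ := hloc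
  have hbound : ∀ z ∈ W, ∃ r > 0, ∃ C : ℝ, 0 < C ∧ ∀ f : ℂ → ℂ, DifferentiableOn ℂ f W →
      ∀ w ∈ closedBall z r,
        ‖f w‖ₑ ≤ ENNReal.ofReal C * eLpNorm f 2 (weightedMeasure W μ) := fun z hz ↦ by
    obtain ⟨R, hR, hRW⟩ := Metric.nhds_basis_closedBall.mem_iff.1 (hW.mem_nhds hz)
    exact ⟨R / 2, half_pos hR, exists_enorm_le_mul_eLpNorm_weightedMeasure hmeas hpos ha hR hRW
      (hint _ hRW (isCompact_closedBall z R))⟩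
  refine ⟨fun z hz ↦ ?_, isClosed_setOf_ae_eq_differentiableOn hW
    ((withDensity_absolutelyContinuous _ _).ae_le (ae_restrict_mem hW.measurableSet)) hbound⟩
  obtain ⟨r, hr, C, hC, hb⟩ := hbound z hz
  refine ⟨C, hC, fun f hf hfi ↦ ?_⟩
  have h := hb f hf z (mem_closedBall_self hr.le)
  have hI : 0 ≤ ∫ w in W, ‖f w‖ ^ 2 * μ w :=
    integral_nonneg_of_ae (hpos.mono fun w hw ↦ by positivity)
  rwa [eLpNorm_two_weightedMeasure_eq_ofReal hmeas hpos hfi, ← ofReal_norm,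
    ← ENNReal.ofReal_mul hC.le, ENNReal.ofReal_le_ofReal_iff (by positivity)] at h
end

section
/- (Harnack's theorem) Let U ⊆ ℝⁿ be a nonempty open connected set and let (h_j) be a sequence of harmonic functions on U that is nondecreasing (h_j(x) ≤ h_{j+1}(x) for all x ∈ U and all j) and converges pointwise on U to a finite-valued function h. Then the convergence h_j → h is locally uniform on U and the limit h is harmonic on U. -/
open Filter Topology

/-- A real-valued function on an open subset of `ℝⁿ` is harmonic there if it is twice
continuously differentiable and its Laplacian `Σₖ ∂²u/∂xₖ²` vanishes on the set. -/
def HarmonicOnE {n : ℕ} (u : EuclideanSpace ℝ (Fin n) → ℝ)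
    (U : Set (EuclideanSpace ℝ (Fin n))) : Prop :=
  ContDiffOn ℝ 2 u U ∧ ∀ x ∈ U,
    ∑ k : Fin n,
      fderiv ℝ (fun y => fderiv ℝ u y (EuclideanSpace.single k 1)) x
        (EuclideanSpace.single k 1) = 0

open MeasureTheory Metric

section Mollifier

variable {n : ℕ}

/-- The smooth radial profile `x⁻² exp (-1/x)`, the derivative of `expNegInvGlue`. -/
noncomputable def radialProfile (x : ℝ) : ℝ := x⁻¹ ^ 2 * expNegInvGlue x

lemma hasDerivAt_expNegInvGlue (x : ℝ) :
    HasDerivAt expNegInvGlue (radialProfile x) x := by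
  simpa [radialProfile] using expNegInvGlue.hasDerivAt_polynomial_eval_inv_mul 1 x

lemma contDiff_radialProfile : ContDiff ℝ (⊤ : ℕ∞) radialProfile := by
  have h := expNegInvGlue.contDiff_polynomial_eval_inv_mul (n := ⊤) (Polynomial.X ^ 2)
  change ContDiff ℝ _ fun x ↦ x⁻¹ ^ 2 * expNegInvGlue x
  simpa using h

lemma radialProfile_of_nonpos {x : ℝ} (hx : x ≤ 0) : radialProfile x = 0 := by
  simp [radialProfile, expNegInvGlue.zero_of_nonpos hx]

lemma radialProfile_pos {x : ℝ} (hx : 0 < x) : 0 < radialProfile x :=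
  mul_pos (by positivity) (expNegInvGlue.pos_of_pos hx)

lemma radialProfile_nonneg (x : ℝ) : 0 ≤ radialProfile x :=
  mul_nonneg (by positivity) (expNegInvGlue.nonneg x)

/-- A smooth nonnegative radial function which is positive exactly on the unit ball. -/
noncomputable def radialBump (y : EuclideanSpace ℝ (Fin n)) : ℝ := radialProfile (1 - ‖y‖ ^ 2)

/-- A compactly supported function whose gradient at `y` is `radialBump y • y`. -/
noncomputable def radialPotential (y : EuclideanSpace ℝ (Fin n)) : ℝ :=
  -(1 / 2) * expNegInvGlue (1 - ‖y‖ ^ 2)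

lemma contDiff_radialBump :
    ContDiff ℝ (⊤ : ℕ∞) (radialBump : EuclideanSpace ℝ (Fin n) → ℝ) :=
  contDiff_radialProfile.comp (contDiff_const.sub (contDiff_norm_sq ℝ))

lemma contDiff_radialPotential :
    ContDiff ℝ (⊤ : ℕ∞) (radialPotential : EuclideanSpace ℝ (Fin n) → ℝ) :=
  contDiff_const.mul (expNegInvGlue.contDiff.comp (contDiff_const.sub (contDiff_norm_sq ℝ)))

lemma radialBump_nonneg (y : EuclideanSpace ℝ (Fin n)) : 0 ≤ radialBump y :=
  radialProfile_nonneg _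

lemma radialBump_neg (y : EuclideanSpace ℝ (Fin n)) : radialBump (-y) = radialBump y := by
  simp [radialBump]

lemma radialBump_pos {y : EuclideanSpace ℝ (Fin n)} (hy : ‖y‖ < 1) : 0 < radialBump y :=
  radialProfile_pos (by nlinarith [norm_nonneg y])

lemma radialBump_eq_zero {y : EuclideanSpace ℝ (Fin n)} (hy : 1 ≤ ‖y‖) : radialBump y = 0 :=
  radialProfile_of_nonpos (by nlinarith)

lemma radialPotential_eq_zero {y : EuclideanSpace ℝ (Fin n)} (hy : 1 ≤ ‖y‖) :
    radialPotential y = 0 := by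
  rw [radialPotential, expNegInvGlue.zero_of_nonpos (by nlinarith), mul_zero]

lemma hasCompactSupport_of_eq_zero_of_le_norm {f : EuclideanSpace ℝ (Fin n) → ℝ} {r : ℝ}
    (hf : ∀ y, r ≤ ‖y‖ → f y = 0) : HasCompactSupport f :=
  HasCompactSupport.intro (isCompact_closedBall 0 r) fun y hy ↦ hf y (by
    simpa using (not_le.1 (mt mem_closedBall_zero_iff.2 hy)).le)

lemma hasCompactSupport_radialBump :
    HasCompactSupport (radialBump : EuclideanSpace ℝ (Fin n) → ℝ) :=
  hasCompactSupport_of_eq_zero_of_le_norm fun _ ↦ radialBump_eq_zero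

lemma hasCompactSupport_radialPotential :
    HasCompactSupport (radialPotential : EuclideanSpace ℝ (Fin n) → ℝ) :=
  hasCompactSupport_of_eq_zero_of_le_norm fun _ ↦ radialPotential_eq_zero

lemma integral_radialBump_pos : 0 < ∫ y : EuclideanSpace ℝ (Fin n), radialBump y :=
  contDiff_radialBump.continuous.integral_pos_of_hasCompactSupport_nonneg_nonzero
    hasCompactSupport_radialBump radialBump_nonneg (radialBump_pos (y := 0) (by simp)).ne'

lemma fderiv_radialPotential_single (y : EuclideanSpace ℝ (Fin n)) (k : Fin n) :
    fderiv ℝ radialPotential y (EuclideanSpace.single k 1) = y k * radialBump y := by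
  have h1 : HasFDerivAt (fun y : EuclideanSpace ℝ (Fin n) ↦ 1 - ‖y‖ ^ 2) _ y :=
    (hasStrictFDerivAt_norm_sq y).hasFDerivAt.const_sub 1
  have h2 : HasFDerivAt radialPotential _ y :=
    ((hasDerivAt_expNegInvGlue (1 - ‖y‖ ^ 2)).comp_hasFDerivAt y h1).const_mul (-(1 / 2))
  rw [h2.fderiv]
  simp [radialBump, EuclideanSpace.inner_single_right]
  ring

lemma EuclideanSpace.sum_apply_mul_clm_single (L : EuclideanSpace ℝ (Fin n) →L[ℝ] ℝ)
    (y : EuclideanSpace ℝ (Fin n)) : L y = ∑ k, y k * L (EuclideanSpace.single k 1) := by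
  conv_lhs => rw [← (EuclideanSpace.basisFun (Fin n) ℝ).sum_repr y]
  simp

end Mollifier

section MeanValue

variable {n : ℕ}

lemma ContDiff.fderiv_apply_const {m : WithTop ℕ∞} {v : EuclideanSpace ℝ (Fin n) → ℝ}
    (hv : ContDiff ℝ (m + 1) v) (e : EuclideanSpace ℝ (Fin n)) :
    ContDiff ℝ m fun y ↦ fderiv ℝ v y e :=
  (hv.fderiv_right le_rfl).clm_apply contDiff_const

lemma integral_fderiv_mul_radialBump_eq_zero {v : EuclideanSpace ℝ (Fin n) → ℝ}
    (hv : ContDiff ℝ 2 v) {x : EuclideanSpace ℝ (Fin n)} {R t : ℝ} (ht : |t| < R)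
    (hharm : HarmonicOnE v (ball x R)) :
    ∫ y, fderiv ℝ v (x + t • y) y * radialBump y = 0 := by
  have hD (k : Fin n) : ContDiff ℝ 1 fun y ↦ fderiv ℝ v y (EuclideanSpace.single k 1) :=
    hv.fderiv_apply_const (m := 1) _
  have hT : ContDiff ℝ 1 fun y : EuclideanSpace ℝ (Fin n) ↦ x + t • y := by fun_prop
  have hDT (k : Fin n) : ContDiff ℝ 1
      fun y ↦ fderiv ℝ v (x + t • y) (EuclideanSpace.single k 1) := (hD k).comp hT
  have hψ : ContDiff ℝ 1 (radialPotential : EuclideanSpace ℝ (Fin n) → ℝ) :=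
    contDiff_radialPotential.of_le (by exact_mod_cast le_top)
  have hcψ := hasCompactSupport_radialPotential (n := n)
  have hψc (k : Fin n) : Continuous fun y : EuclideanSpace ℝ (Fin n) ↦
      fderiv ℝ radialPotential y (EuclideanSpace.single k 1) :=
    (hψ.continuous_fderiv one_ne_zero).clm_apply continuous_const
  have hi1 (k : Fin n) : Integrable fun y ↦ fderiv ℝ v (x + t • y) (EuclideanSpace.single k 1) *
      fderiv ℝ radialPotential y (EuclideanSpace.single k 1) :=
    ((hDT k).continuous.mul (hψc k)).integrable_of_hasCompactSupport
      (hcψ.fderiv_apply ℝ _).mul_left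
  have hderiv (k : Fin n) (y : EuclideanSpace ℝ (Fin n)) :
      fderiv ℝ (fun y ↦ fderiv ℝ v (x + t • y) (EuclideanSpace.single k 1)) y
        (EuclideanSpace.single k 1) =
      t * fderiv ℝ (fun y ↦ fderiv ℝ v y (EuclideanSpace.single k 1)) (x + t • y)
        (EuclideanSpace.single k 1) := by
    have h1 : HasFDerivAt (fun y : EuclideanSpace ℝ (Fin n) ↦ x + t • y) _ y :=
      ((hasFDerivAt_id (𝕜 := ℝ) y).const_smul t).const_add x
    have h2 := ((((hD k).differentiable one_ne_zero) (x + t • y)).hasFDerivAt.comp y h1).fderiv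
    change fderiv ℝ ((fun y ↦ fderiv ℝ v y (EuclideanSpace.single k 1)) ∘ fun y ↦ x + t • y) y _ = _
    rw [h2]
    simp
  have hi2 (k : Fin n) : Integrable fun y ↦
      fderiv ℝ (fun y ↦ fderiv ℝ v (x + t • y) (EuclideanSpace.single k 1)) y
        (EuclideanSpace.single k 1) * radialPotential y :=
    ((((hDT k).continuous_fderiv one_ne_zero).clm_apply continuous_const).mul
      hψ.continuous).integrable_of_hasCompactSupport hcψ.mul_left
  calc ∫ y, fderiv ℝ v (x + t • y) y * radialBump y
      = ∫ y, ∑ k, fderiv ℝ v (x + t • y) (EuclideanSpace.single k 1) *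
          fderiv ℝ radialPotential y (EuclideanSpace.single k 1) := by
        congr 1 with y
        rw [EuclideanSpace.sum_apply_mul_clm_single, Finset.sum_mul]
        refine Finset.sum_congr rfl fun k _ ↦ ?_
        rw [fderiv_radialPotential_single]
        ring
    _ = ∑ k, ∫ y, fderiv ℝ v (x + t • y) (EuclideanSpace.single k 1) *
          fderiv ℝ radialPotential y (EuclideanSpace.single k 1) :=
        integral_finsetSum _ fun k _ ↦ hi1 k
    _ = ∑ k, -∫ y, fderiv ℝ (fun y ↦ fderiv ℝ v (x + t • y) (EuclideanSpace.single k 1)) y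
          (EuclideanSpace.single k 1) * radialPotential y :=
        Finset.sum_congr rfl fun k _ ↦ integral_mul_fderiv_eq_neg_fderiv_mul_of_integrable
          (hi2 k) (hi1 k) (((hDT k).continuous.mul hψ.continuous).integrable_of_hasCompactSupport
            hcψ.mul_left) (fun y _ ↦ (hDT k).differentiable one_ne_zero y)
          (fun y _ ↦ hψ.differentiable one_ne_zero y)
    _ = -∫ y, t * (∑ k, fderiv ℝ (fun y ↦ fderiv ℝ v y (EuclideanSpace.single k 1)) (x + t • y)
          (EuclideanSpace.single k 1)) * radialPotential y := by
        rw [Finset.sum_neg_distrib, ← integral_finsetSum _ fun k _ ↦ hi2 k]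
        congr 2 with y
        simp_rw [hderiv, Finset.mul_sum, Finset.sum_mul]
    _ = 0 := by
        rw [neg_eq_zero]
        refine integral_eq_zero_of_ae (.of_forall fun y ↦ ?_)
        rcases le_or_gt 1 ‖y‖ with hy | hy
        · simp [radialPotential_eq_zero hy]
        · have hmem : x + t • y ∈ ball x R := by
            rw [mem_ball, dist_eq_norm, add_sub_cancel_left, norm_smul, Real.norm_eq_abs]
            nlinarith [abs_nonneg t, norm_nonneg y]
          simp [hharm.2 _ hmem]

/-- The weighted mean value property for globally defined functions. -/
lemma integral_comp_add_smul_mul_radialBump {v : EuclideanSpace ℝ (Fin n) → ℝ}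
    (hv : ContDiff ℝ 2 v) (hvc : HasCompactSupport v) {x : EuclideanSpace ℝ (Fin n)} {R ε : ℝ}
    (hε : 0 < ε) (hεR : ε < R) (hharm : HarmonicOnE v (ball x R)) :
    ∫ y, v (x + ε • y) * radialBump y = v x * ∫ y : EuclideanSpace ℝ (Fin n), radialBump y := by
  have hφ := contDiff_radialBump (n := n).continuous
  have hφc := hasCompactSupport_radialBump (n := n)
  obtain ⟨M, hM⟩ := (hvc.fderiv ℝ).exists_bound_of_continuous
    (hv.continuous_fderiv two_ne_zero)
  have hcont (t : ℝ) : Continuous fun y ↦ v (x + t • y) * radialBump y :=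
    (hv.continuous.comp (by fun_prop)).mul hφ
  have hderiv (t : ℝ) : HasDerivAt (fun t : ℝ ↦ ∫ y, v (x + t • y) * radialBump y)
      (∫ y, fderiv ℝ v (x + t • y) y * radialBump y) t := by
    refine (hasDerivAt_integral_of_dominated_loc_of_deriv_le (s := Set.univ)
      (F := fun t y ↦ v (x + t • y) * radialBump y)
      (F' := fun t y ↦ fderiv ℝ v (x + t • y) y * radialBump y)
      (bound := fun y ↦ M * ‖y‖ * radialBump y) Filter.univ_mem
      (.of_forall fun t ↦ (hcont t).aestronglyMeasurable)
      ((hcont t).integrable_of_hasCompactSupport hφc.mul_left) ?_ ?_ ?_ ?_).2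
    · exact ((((hv.continuous_fderiv two_ne_zero).comp (by fun_prop)).clm_apply
        continuous_id).mul hφ).aestronglyMeasurable
    · refine .of_forall fun y t _ ↦ ?_
      rw [norm_mul, Real.norm_of_nonneg (radialBump_nonneg y)]
      exact mul_le_mul_of_nonneg_right ((fderiv ℝ v (x + t • y)).le_of_opNorm_le (hM _) y)
        (radialBump_nonneg y)
    · exact ((continuous_const.mul continuous_norm).mul hφ).integrable_of_hasCompactSupport
        hφc.mul_left
    · refine .of_forall fun y t _ ↦ ?_
      have h1 : HasDerivAt (fun t : ℝ ↦ x + t • y) y t := by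
        simpa using ((hasDerivAt_id t).smul_const y).const_add x
      exact ((hv.differentiable two_ne_zero _).hasFDerivAt.comp_hasDerivAt t h1).mul_const _
  have hconst := constant_of_has_deriv_right_zero (a := 0) (b := ε)
    (fun t _ ↦ (hderiv t).continuousAt.continuousWithinAt) (fun t ht ↦ by
      have h := (hderiv t).hasDerivWithinAt (s := Set.Ici t)
      rwa [integral_fderiv_mul_radialBump_eq_zero hv
        (by rw [abs_of_nonneg ht.1]; exact ht.2.trans hεR) hharm] at h) ε ⟨hε.le, le_rfl⟩
  rw [hconst]
  simp [integral_const_mul]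

lemma HarmonicOnE.congr {u v : EuclideanSpace ℝ (Fin n) → ℝ} {V : Set (EuclideanSpace ℝ (Fin n))}
    (hu : HarmonicOnE u V) (hV : IsOpen V) (h : Set.EqOn v u V) : HarmonicOnE v V := by
  refine ⟨hu.1.congr h, fun x hx ↦ ?_⟩
  rw [← hu.2 x hx]
  refine Finset.sum_congr rfl fun k _ ↦ ?_
  have h1 : (fun y ↦ fderiv ℝ v y (EuclideanSpace.single k 1)) =ᶠ[𝓝 x]
      fun y ↦ fderiv ℝ u y (EuclideanSpace.single k 1) := by
    filter_upwards [hV.mem_nhds hx] with y hy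
    rw [(h.eventuallyEq_of_mem (hV.mem_nhds hy)).fderiv_eq]
  rw [h1.fderiv_eq]

lemma HarmonicOnE.mono {u : EuclideanSpace ℝ (Fin n) → ℝ} {U V : Set (EuclideanSpace ℝ (Fin n))}
    (hu : HarmonicOnE u U) (hVU : V ⊆ U) : HarmonicOnE u V :=
  ⟨hu.1.mono hVU, fun x hx ↦ hu.2 x (hVU hx)⟩

lemma HarmonicOnE.integral_comp_add_smul_mul_radialBump {u : EuclideanSpace ℝ (Fin n) → ℝ}
    {x : EuclideanSpace ℝ (Fin n)} {R ε : ℝ} (hε : 0 < ε) (hεR : ε < R)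
    (hu : HarmonicOnE u (ball x R)) :
    ∫ y, u (x + ε • y) * radialBump y = u x * ∫ y : EuclideanSpace ℝ (Fin n), radialBump y := by
  obtain ⟨a, ha, haR⟩ := exists_between hεR
  obtain ⟨b, hb, hbR⟩ := exists_between haR
  let χ : ContDiffBump x := ⟨a, b, hε.trans ha, hb⟩
  have hχ : tsupport (fun y ↦ χ y * u y) ⊆ closedBall x b :=
    (tsupport_mul_subset_left).trans χ.tsupport_eq.subset
  have hone : Set.EqOn (fun y ↦ χ y * u y) u (ball x a) := fun y hy ↦ by
    simp [χ.one_of_mem_closedBall (ball_subset_closedBall hy)]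
  have hv : ContDiff ℝ 2 fun y ↦ χ y * u y := by
    refine contDiff_iff_contDiffAt.2 fun y ↦ ?_
    by_cases hy : y ∈ tsupport fun y ↦ χ y * u y
    · exact χ.contDiffAt.mul (hu.1.contDiffAt (isOpen_ball.mem_nhds
        (closedBall_subset_ball hbR (hχ hy))))
    · exact contDiffAt_const.congr_of_eventuallyEq (notMem_tsupport_iff_eventuallyEq.1 hy)
  have := _root_.integral_comp_add_smul_mul_radialBump hv χ.hasCompactSupport.mul_right hε ha
    ((hu.mono (ball_subset_ball haR.le)).congr isOpen_ball hone)
  have hx := hone (mem_ball_self (hε.trans ha))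
  simp only at hx this
  rw [← hx, ← this]
  congr 1 with y
  rcases le_or_gt 1 ‖y‖ with hy | hy
  · simp [radialBump_eq_zero hy]
  · have hmem : x + ε • y ∈ ball x a := by
      rw [mem_ball, dist_eq_norm, add_sub_cancel_left, norm_smul, Real.norm_of_nonneg hε.le]
      nlinarith [norm_nonneg y]
    exact congrArg (· * radialBump y) (hone hmem).symm

/-- A smooth nonnegative kernel, positive exactly on the ball of radius `ε`, which reproduces
harmonic functions. -/
lemma exists_reproducing_kernel {ε : ℝ} (hε : 0 < ε) :
    ∃ K : EuclideanSpace ℝ (Fin n) → ℝ, ContDiff ℝ (⊤ : ℕ∞) K ∧ (∀ z, 0 ≤ K z) ∧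
      (∀ z, ‖z‖ < ε → 0 < K z) ∧ (∀ z, ε ≤ ‖z‖ → K z = 0) ∧
      ∀ (u : EuclideanSpace ℝ (Fin n) → ℝ) (x : EuclideanSpace ℝ (Fin n)) (R : ℝ), ε < R →
        HarmonicOnE u (ball x R) → u x = ∫ w, u w * K (x - w) := by
  have hI := integral_radialBump_pos (n := n)
  set I := ∫ y : EuclideanSpace ℝ (Fin n), radialBump y with hIdef
  have hnorm (z : EuclideanSpace ℝ (Fin n)) : ‖ε⁻¹ • z‖ = ‖z‖ / ε := by
    rw [norm_smul, norm_inv, Real.norm_of_nonneg hε.le, inv_mul_eq_div]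
  refine ⟨fun z ↦ (I * ε ^ n)⁻¹ * radialBump (ε⁻¹ • z),
    contDiff_const.mul (contDiff_radialBump.comp (contDiff_const_smul _)),
    fun z ↦ mul_nonneg (by positivity) (radialBump_nonneg _),
    fun z hz ↦ mul_pos (by positivity) (radialBump_pos ?_),
    fun z hz ↦ mul_eq_zero_of_right _ (radialBump_eq_zero ?_),
    fun u x R hR hu ↦ ?_⟩
  · rwa [hnorm, div_lt_one hε]
  · rwa [hnorm, one_le_div hε]
  · have hmv := hu.integral_comp_add_smul_mul_radialBump hε hR
    have hcv := Measure.integral_comp_inv_smul (μ := (volume : Measure (EuclideanSpace ℝ (Fin n))))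
      (fun y ↦ u (x + ε • y) * radialBump y) ε
    have htr := integral_sub_right_eq_self (μ := (volume : Measure (EuclideanSpace ℝ (Fin n))))
      (fun w ↦ u (x + w) * radialBump (ε⁻¹ • w)) x
    simp only [smul_inv_smul₀ hε.ne', finrank_euclideanSpace_fin, smul_eq_mul, hmv,
      abs_of_pos (pow_pos hε n)] at hcv
    rw [hcv] at htr
    have : ∀ w, u w * ((I * ε ^ n)⁻¹ * radialBump (ε⁻¹ • (x - w))) =
        (I * ε ^ n)⁻¹ * (u (x + (w - x)) * radialBump (ε⁻¹ • (w - x))) := fun w ↦ by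
      rw [add_sub_cancel, ← radialBump_neg, ← smul_neg, neg_sub]
      ring
    simp_rw [this, integral_const_mul, htr]
    rw [← hIdef]
    field_simp

end MeanValue

section Harnack

variable {n : ℕ}

lemma integrable_mul_comp_sub {f K : EuclideanSpace ℝ (Fin n) → ℝ} {x : EuclideanSpace ℝ (Fin n)}
    {ε : ℝ} (hf : ContinuousOn f (closedBall x ε)) (hK : Continuous K)
    (hK0 : ∀ z, ε ≤ ‖z‖ → K z = 0) : Integrable fun w ↦ f w * K (x - w) := by
  rw [← integrableOn_iff_integrable_of_support_subset (s := closedBall x ε)]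
  · exact (hf.mul (hK.comp (by fun_prop)).continuousOn).integrableOn_compact
      (isCompact_closedBall x ε)
  · intro w hw
    by_contra h
    refine hw (mul_eq_zero_of_right _ (hK0 _ ?_))
    rw [mem_closedBall, not_le, dist_comm, dist_eq_norm] at h
    exact h.le

/-- **Harnack's inequality** for nonnegative harmonic functions on balls of radius `4 * r`. -/
lemma exists_harnack_constant {r : ℝ} (hr : 0 < r) :
    ∃ C : ℝ, ∀ (u : EuclideanSpace ℝ (Fin n) → ℝ) (x : EuclideanSpace ℝ (Fin n)),
      HarmonicOnE u (ball x (4 * r)) → (∀ w ∈ ball x (4 * r), 0 ≤ u w) →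
        ∀ y ∈ ball x r, u y ≤ C * u x := by
  obtain ⟨K, hK, hKnn, -, hK0, hKrep⟩ := exists_reproducing_kernel (n := n) hr
  obtain ⟨L, hL, hLnn, hLpos, hL0, hLrep⟩ :=
    exists_reproducing_kernel (n := n) (ε := 3 * r) (by positivity)
  obtain ⟨M, hM⟩ := (hasCompactSupport_of_eq_zero_of_le_norm hK0).exists_bound_of_continuous
    hK.continuous
  obtain ⟨z₀, hz₀, hmin⟩ := (isCompact_closedBall (0 : EuclideanSpace ℝ (Fin n))
    (2 * r)).exists_isMinOn ⟨0, mem_closedBall_self (by positivity)⟩ hL.continuous.continuousOn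
  have hm : 0 < L z₀ := hLpos _ (by linarith [mem_closedBall_zero_iff.1 hz₀])
  have hM0 : 0 ≤ M := (norm_nonneg _).trans (hM 0)
  refine ⟨M / L z₀, fun u x hu hnn y hy ↦ ?_⟩
  have hxy : ‖x - y‖ < r := by rwa [← dist_eq_norm, dist_comm]
  rw [hKrep u y (2 * r) (by linarith) (hu.mono (ball_subset_ball' (by
    linarith [mem_ball.1 hy]))), hLrep u x (4 * r) (by linarith) hu, ← integral_const_mul]
  have hcont := hu.1.continuousOn
  refine integral_mono (integrable_mul_comp_sub (hcont.mono (closedBall_subset_ball' (by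
    linarith [mem_ball.1 hy]))) hK.continuous hK0) ((integrable_mul_comp_sub (hcont.mono
    (closedBall_subset_ball (by linarith))) hL.continuous hL0).const_mul _) fun w ↦ ?_
  rcases le_or_gt (3 * r) ‖x - w‖ with hw | hw
  · have : r ≤ ‖y - w‖ := by
      have := norm_sub_le_norm_sub_add_norm_sub x y w
      linarith
    simp [hL0 _ hw, hK0 _ this]
  · have huw : 0 ≤ u w := hnn w (by
      rw [mem_ball, dist_comm, dist_eq_norm]
      linarith)
    suffices h : K (y - w) ≤ M / L z₀ * L (x - w) by
      calc u w * K (y - w) ≤ u w * (M / L z₀ * L (x - w)) := mul_le_mul_of_nonneg_left h huw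
        _ = _ := by ring
    rcases le_or_gt r ‖y - w‖ with hyw | hyw
    · rw [hK0 _ hyw]
      exact mul_nonneg (by positivity) (hLnn _)
    · have h1 : L z₀ ≤ L (x - w) := hmin (mem_closedBall_zero_iff.2 (by
        have := norm_sub_le_norm_sub_add_norm_sub x y w
        linarith))
      calc K (y - w) ≤ M := (le_abs_self _).trans (hM _)
        _ = M / L z₀ * L z₀ := by field_simp
        _ ≤ _ := by gcongr

open scoped Convolution in
lemma fderiv_convolution_apply {f K : EuclideanSpace ℝ (Fin n) → ℝ} (hf : LocallyIntegrable f)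
    (hKc : HasCompactSupport K) (hK : ContDiff ℝ 1 K) (x e : EuclideanSpace ℝ (Fin n)) :
    fderiv ℝ (f ⋆[ContinuousLinearMap.mul ℝ ℝ] K) x e =
      (f ⋆[ContinuousLinearMap.mul ℝ ℝ] fun z ↦ fderiv ℝ K z e) x := by
  rw [(hKc.hasFDerivAt_convolution_right _ hf hK x).fderiv, convolution_precompR_apply _ hf
    (hKc.fderiv ℝ) (hK.continuous_fderiv one_ne_zero)]

open scoped Convolution in
lemma fderiv_fderiv_apply_of_eqOn_convolution {u f K : EuclideanSpace ℝ (Fin n) → ℝ}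
    {V : Set (EuclideanSpace ℝ (Fin n))} (hV : IsOpen V)
    (hu : Set.EqOn u (f ⋆[ContinuousLinearMap.mul ℝ ℝ] K) V) (hf : LocallyIntegrable f)
    (hKc : HasCompactSupport K) (hK : ContDiff ℝ 2 K) {x : EuclideanSpace ℝ (Fin n)} (hx : x ∈ V)
    (e : EuclideanSpace ℝ (Fin n)) :
    fderiv ℝ (fun y ↦ fderiv ℝ u y e) x e =
      (f ⋆[ContinuousLinearMap.mul ℝ ℝ] fun z ↦ fderiv ℝ (fun y ↦ fderiv ℝ K y e) z e) x := by
  have h1 : (fun y ↦ fderiv ℝ u y e) =ᶠ[𝓝 x]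
      (f ⋆[ContinuousLinearMap.mul ℝ ℝ] fun z ↦ fderiv ℝ K z e) := by
    filter_upwards [hV.mem_nhds hx] with y hy
    rw [(hu.eventuallyEq_of_mem (hV.mem_nhds hy)).fderiv_eq,
      fderiv_convolution_apply hf hKc (hK.of_le one_le_two)]
  rw [h1.fderiv_eq, fderiv_convolution_apply hf (hKc.fderiv_apply ℝ e)
    (hK.fderiv_apply_const (m := 1) e)]

/-- A monotone pointwise limit of
harmonic functions is harmonic as soon as it is continuous. -/
lemma HarmonicOnE.of_monotone_tendsto {U : Set (EuclideanSpace ℝ (Fin n))} (hU : IsOpen U)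
    {h : ℕ → EuclideanSpace ℝ (Fin n) → ℝ} (hharm : ∀ j, HarmonicOnE (h j) U)
    (hmono : ∀ x ∈ U, Monotone fun j ↦ h j x) {g : EuclideanSpace ℝ (Fin n) → ℝ}
    (hg : ContinuousOn g U) (hlim : ∀ x ∈ U, Tendsto (fun j ↦ h j x) atTop (𝓝 (g x))) :
    HarmonicOnE g U := by
  suffices H : ∀ x ∈ U, ContDiffAt ℝ 2 g x ∧ ∑ k : Fin n,
      fderiv ℝ (fun y => fderiv ℝ g y (EuclideanSpace.single k 1)) x
        (EuclideanSpace.single k 1) = 0 from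
    ⟨fun x hx ↦ (H x hx).1.contDiffWithinAt, fun x hx ↦ (H x hx).2⟩
  intro x hx
  obtain ⟨R, hR, hRU⟩ := isOpen_iff.1 hU x hx
  obtain ⟨r, hr, rfl⟩ : ∃ r, 0 < r ∧ 4 * r = R := ⟨R / 4, by positivity, by ring⟩
  obtain ⟨K, hK, -, -, hK0, hrep⟩ := exists_reproducing_kernel (n := n) hr
  have hKc := hasCompactSupport_of_eq_zero_of_le_norm hK0
  have hK2 : ContDiff ℝ 2 K := contDiff_infty.1 hK 2
  set B := closedBall x (2 * r)
  have hBU : B ⊆ U := (closedBall_subset_ball (by linarith)).trans hRU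
  have hBc : IsCompact B := isCompact_closedBall _ _
  have hint {f : EuclideanSpace ℝ (Fin n) → ℝ} (hf : ContinuousOn f U) :
      Integrable (B.indicator f) :=
    (hf.mono hBU).integrableOn_compact hBc |>.integrable_indicator hBc.measurableSet
  have hhc (j : ℕ) : ContinuousOn (h j) U := (hharm j).1.continuousOn
  have hconv {ψ : EuclideanSpace ℝ (Fin n) → ℝ} (hψ : Continuous ψ) (hψc : HasCompactSupport ψ)
      (y : EuclideanSpace ℝ (Fin n)) :
      Tendsto (fun j ↦ convolution (B.indicator (h j)) ψ (ContinuousLinearMap.mul ℝ ℝ) volume y)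
        atTop (𝓝 (convolution (B.indicator g) ψ (ContinuousLinearMap.mul ℝ ℝ) volume y)) := by
    obtain ⟨M, hM⟩ := hψc.exists_bound_of_continuous hψ
    have hM0 : 0 ≤ M := (norm_nonneg _).trans (hM 0)
    refine tendsto_integral_of_dominated_convergence
      (fun w ↦ (|B.indicator (h 0) w| + |B.indicator g w|) * M) (fun j ↦ ?_) ?_ (fun j ↦ ?_) ?_
    · exact (hint (hhc j)).aestronglyMeasurable.mul
        (hψ.comp (by fun_prop)).aestronglyMeasurable
    · exact ((hint (hhc 0)).abs.add (hint hg).abs).mul_const M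
    · refine .of_forall fun w ↦ ?_
      simp only [ContinuousLinearMap.mul_apply', norm_mul]
      refine mul_le_mul ?_ (hM _) (norm_nonneg _) (by positivity)
      by_cases hw : w ∈ B
      · simp only [hw, Set.indicator_of_mem, Real.norm_eq_abs]
        have h1 := hmono w (hBU hw) (Nat.zero_le j)
        have h2 := (hmono w (hBU hw)).ge_of_tendsto (hlim w (hBU hw)) j
        exact (abs_le_max_abs_abs h1 h2).trans (max_le_add_of_nonneg (abs_nonneg _) (abs_nonneg _))
      · simp [hw]
    · refine .of_forall fun w ↦ ?_
      refine Tendsto.mul_const _ ?_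
      by_cases hw : w ∈ B
      · simpa [hw] using hlim w (hBU hw)
      · simp [hw]
  have hrepj (j : ℕ) : Set.EqOn (h j)
      (convolution (B.indicator (h j)) K (ContinuousLinearMap.mul ℝ ℝ) volume) (ball x r) := by
    intro y hy
    rw [hrep (h j) y (2 * r) (by linarith) ((hharm j).mono ((ball_subset_ball' (by
      linarith [mem_ball.1 hy])).trans hRU)), convolution_def]
    congr 1 with w
    by_cases hw : w ∈ B
    · simp [hw]
    · have : r ≤ ‖y - w‖ := by
        have h1 : 2 * r < dist w x := not_le.1 hw
        have h2 := dist_triangle w y x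
        rw [dist_comm w y, dist_eq_norm y w] at h2
        linarith [mem_ball.1 hy]
      simp [hK0 _ this]
  have hrepg : Set.EqOn g (convolution (B.indicator g) K (ContinuousLinearMap.mul ℝ ℝ) volume)
      (ball x r) := fun y hy ↦
    tendsto_nhds_unique (hlim y (hRU (ball_subset_ball (by linarith) hy)))
      ((hconv hK.continuous hKc y).congr fun j ↦ (hrepj j hy).symm)
  have hxr : x ∈ ball x r := mem_ball_self hr
  refine ⟨((hKc.contDiff_convolution_right _ (hint hg).locallyIntegrable hK2).contDiffAt
    (x := x)).congr_of_eventuallyEq (hrepg.eventuallyEq_of_mem (isOpen_ball.mem_nhds hxr)), ?_⟩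
  have hsum : Tendsto (fun j ↦ ∑ k : Fin n,
      fderiv ℝ (fun y => fderiv ℝ (h j) y (EuclideanSpace.single k 1)) x
        (EuclideanSpace.single k 1)) atTop (𝓝 (∑ k : Fin n,
      fderiv ℝ (fun y => fderiv ℝ g y (EuclideanSpace.single k 1)) x
        (EuclideanSpace.single k 1))) := by
    refine tendsto_finsetSum _ fun k _ ↦ ?_
    rw [fderiv_fderiv_apply_of_eqOn_convolution isOpen_ball hrepg (hint hg).locallyIntegrable
      hKc hK2 hxr]
    refine (hconv ?_ ((hKc.fderiv_apply ℝ _).fderiv_apply ℝ _) x).congr fun j ↦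
      (fderiv_fderiv_apply_of_eqOn_convolution isOpen_ball (hrepj j)
        (hint (hhc j)).locallyIntegrable hKc hK2 hxr _).symm
    exact ((hK2.fderiv_apply_const (m := 1) _).continuous_fderiv one_ne_zero).clm_apply
      continuous_const
  refine tendsto_nhds_unique hsum ?_
  simp only [(hharm _).2 x hx, tendsto_const_nhds]

lemma HarmonicOnE.sub {u v : EuclideanSpace ℝ (Fin n) → ℝ} {U : Set (EuclideanSpace ℝ (Fin n))}
    (hU : IsOpen U) (hu : HarmonicOnE u U) (hv : HarmonicOnE v U) :
    HarmonicOnE (fun x ↦ u x - v x) U := by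
  refine ⟨hu.1.sub hv.1, fun x hx ↦ ?_⟩
  have hdiff {f : EuclideanSpace ℝ (Fin n) → ℝ} (hf : ContDiffOn ℝ 2 f U)
      (e : EuclideanSpace ℝ (Fin n)) : DifferentiableAt ℝ (fun y ↦ fderiv ℝ f y e) x :=
    ((((hf.contDiffAt (hU.mem_nhds hx)).fderiv_right (m := 1) le_rfl).differentiableAt
      one_ne_zero).clm_apply (differentiableAt_const e))
  have h0 := congrArg₂ (· - ·) (hu.2 x hx) (hv.2 x hx)
  simp only [sub_zero, ← Finset.sum_sub_distrib] at h0
  rw [← h0]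
  refine Finset.sum_congr rfl fun k _ ↦ ?_
  have h1 : (fun y ↦ fderiv ℝ (fun x ↦ u x - v x) y (EuclideanSpace.single k 1)) =ᶠ[𝓝 x]
      fun y ↦ fderiv ℝ u y (EuclideanSpace.single k 1) -
        fderiv ℝ v y (EuclideanSpace.single k 1) := by
    filter_upwards [hU.mem_nhds hx] with y hy
    rw [fderiv_fun_sub ((hu.1.contDiffAt (hU.mem_nhds hy)).differentiableAt two_ne_zero)
      ((hv.1.contDiffAt (hU.mem_nhds hy)).differentiableAt two_ne_zero)]
    rfl
  rw [h1.fderiv_eq, fderiv_fun_sub (hdiff hu.1 _) (hdiff hv.1 _)]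
  rfl

lemma HarmonicOnE.tendstoLocallyUniformlyOn_of_monotone {U : Set (EuclideanSpace ℝ (Fin n))}
    (hU : IsOpen U) {h : ℕ → EuclideanSpace ℝ (Fin n) → ℝ} (hharm : ∀ j, HarmonicOnE (h j) U)
    (hmono : ∀ x ∈ U, Monotone fun j ↦ h j x) {g : EuclideanSpace ℝ (Fin n) → ℝ}
    (hlim : ∀ x ∈ U, Tendsto (fun j ↦ h j x) atTop (𝓝 (g x))) :
    TendstoLocallyUniformlyOn h g atTop U := by
  rw [Metric.tendstoLocallyUniformlyOn_iff]
  intro ε hε x hx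
  obtain ⟨R, hR, hRU⟩ := isOpen_iff.1 hU x hx
  obtain ⟨r, hr, rfl⟩ : ∃ r, 0 < r ∧ 4 * r = R := ⟨R / 4, by positivity, by ring⟩
  obtain ⟨C, hC⟩ := exists_harnack_constant (n := n) hr
  refine ⟨ball x r, mem_nhdsWithin_of_mem_nhds (ball_mem_nhds x hr), ?_⟩
  have hsmall : Tendsto (fun j ↦ C * (g x - h j x)) atTop (𝓝 0) := by
    simpa using ((hlim x hx).const_sub (g x)).const_mul C
  filter_upwards [hsmall.eventually_lt_const hε] with i hi y hy
  have hyU : y ∈ U := hRU (ball_subset_ball (by linarith) hy)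
  have hle : g y - h i y ≤ C * (g x - h i x) := by
    refine le_of_tendsto_of_tendsto ((hlim y hyU).sub_const (h i y))
      (((hlim x hx).sub_const (h i x)).const_mul C) ?_
    filter_upwards [eventually_ge_atTop i] with j hj
    exact hC _ x (((hharm j).sub hU (hharm i)).mono hRU)
      (fun w hw ↦ sub_nonneg.2 (hmono w (hRU hw) hj)) y hy
  rw [Real.dist_eq, abs_of_nonneg
    (sub_nonneg.2 ((hmono y hyU).ge_of_tendsto (hlim y hyU) i))]
  exact hle.trans_lt hi

end Harnack

/-- Harnack's theorem: a nondecreasing sequence of harmonic functions on a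
nonempty open connected set `U ⊆ ℝⁿ` converging pointwise to a finite limit converges
locally uniformly, and the limit is harmonic. -/
theorem harnack {n : ℕ} (U : Set (EuclideanSpace ℝ (Fin n)))
    (hU : IsOpen U) (hUconn : IsConnected U)
    (h : ℕ → EuclideanSpace ℝ (Fin n) → ℝ)
    (hharm : ∀ j, HarmonicOnE (h j) U)
    (hmono : ∀ j, ∀ x ∈ U, h j x ≤ h (j + 1) x)
    (g : EuclideanSpace ℝ (Fin n) → ℝ)
    (hlim : ∀ x ∈ U, Tendsto (fun j => h j x) atTop (𝓝 (g x))) :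
    TendstoLocallyUniformlyOn h g atTop U ∧ HarmonicOnE g U := by
  have hmono' : ∀ x ∈ U, Monotone fun j ↦ h j x := fun x hx ↦
    monotone_nat_of_le_succ fun j ↦ hmono j x hx
  have hunif := HarmonicOnE.tendstoLocallyUniformlyOn_of_monotone hU hharm hmono' hlim
  exact ⟨hunif, .of_monotone_tendsto hU hharm hmono' (hunif.continuousOn
    (.of_forall fun j ↦ (hharm j).1.continuousOn)) hlim⟩
end
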